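/- Let α be a 3-CNF formula with m clauses, each clause having exactly three literals and each variable appearing at most once per clause, and let G_α be the associated graph. If G_α admits a path-oblivious 1-rounding, then α is satisfiable. A satisfying assignment is obtained by setting x_i to true if the edge e(v_{i,0}) is rounded down and to false if it is rounded up. -/

import Mathlib

open SimpleGraph

/-! ## Generic shortest-path and rounding definitions -/

noncomputable def wWeight {V : Type*} {G : SimpleGraph V} (w : V → V → ℝ) {u v : V}
    (p : G.Walk u v) : ℝ :=
  (p.darts.map (fun d => w d.toProd.1 d.toProd.2)).sum

def IsShortestPath {V : Type*} {G : SimpleGraph V} (w : V → V → ℝ) {u v : V}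
    (p : G.Walk u v) : Prop :=
  p.IsPath ∧ ∀ q : G.Walk u v, wWeight w p ≤ wWeight w q

def PathObliviousRounding {V : Type*} (G : SimpleGraph V) (w : V → V → ℝ) (wt : V → V → ℕ)
    (ε : ℝ) : Prop :=
  ∀ (u v : V) (p : G.Walk u v), IsShortestPath w p →
    |wWeight (fun a b => (wt a b : ℝ)) p - wWeight w p| < ε

def WeakRounding {V : Type*} (G : SimpleGraph V) (w : V → V → ℝ) (wt : V → V → ℕ)
    (ε : ℝ) : Prop :=
  PathObliviousRounding G w wt ε ∧
  ∀ (u v : V) (p : G.Walk u v), IsShortestPath w p →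
    IsShortestPath (fun a b => (wt a b : ℝ)) p

def StrongRounding {V : Type*} (G : SimpleGraph V) (w : V → V → ℝ) (wt : V → V → ℕ)
    (ε : ℝ) : Prop :=
  WeakRounding G w wt ε ∧
  ∀ (u v : V) (p : G.Walk u v), IsShortestPath (fun a b => (wt a b : ℝ)) p →
    IsShortestPath w p

/-! ## The construction of `G_α`

A 3-CNF formula `α` with `m` clauses over `n` variables is given by
`C : Fin m → Fin 3 → Fin n × Bool`: the `t`-th literal of clause `j` is the variable
`(C j t).1` with polarity `(C j t).2` (`true` = positive literal, `false` = negated). -/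

variable {n m : ℕ}

/-- The occurrences of variable `i` in `α`, as the lexicographically ordered list of
pairs `(j, t)` such that the `t`-th literal of clause `j` involves `x_i`. -/
def occs (C : Fin m → Fin 3 → Fin n × Bool) (i : Fin n) : List (Fin m × Fin 3) :=
  ((List.finRange m).product (List.finRange 3)).filter (fun q => (C q.1 q.2).1 = i)

/-- The number `h` of literals of `α` involving variable `i`. -/
def hocc (C : Fin m → Fin 3 → Fin n × Bool) (i : Fin n) : ℕ := (occs C i).length

/-- The vertices of the variable gadget for `x_i`: for each occurrence `k` a triangle
`Δ_{i,k}` with left (`0`), right (`1`) and base (`2`) vertex; two pendant vertices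
(`false` = `v_{i,0}`, `true` = `v_{i,h+1}`); and an inverter vertex for each negated
occurrence. -/
def VarV (C : Fin m → Fin 3 → Fin n × Bool) (i : Fin n) : Type :=
  (Fin (hocc C i) × Fin 3) ⊕
    (Bool ⊕ {k : Fin (hocc C i) //
      (C ((occs C i).get k).1 ((occs C i).get k).2).2 = false})

/-- The vertices of the clause gadget for `C_j`: a nine-cycle, three knobs, and a centre. -/
def ClauseV : Type := (Fin 9 ⊕ Fin 3) ⊕ Unit

/-- The vertex set of `G_α`. -/
def GV (C : Fin m → Fin 3 → Fin n × Bool) : Type :=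
  (Σ i : Fin n, VarV C i) ⊕ (Fin m × ClauseV)

def vtri (C : Fin m → Fin 3 → Fin n × Bool) (i : Fin n) (k : Fin (hocc C i)) (x : Fin 3) :
    GV C := Sum.inl ⟨i, Sum.inl (k, x)⟩

def vpend (C : Fin m → Fin 3 → Fin n × Bool) (i : Fin n) (b : Bool) : GV C :=
  Sum.inl ⟨i, Sum.inr (Sum.inl b)⟩

def vinv (C : Fin m → Fin 3 → Fin n × Bool) (i : Fin n) (k : Fin (hocc C i))
    (hk : (C ((occs C i).get k).1 ((occs C i).get k).2).2 = false) : GV C :=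
  Sum.inl ⟨i, Sum.inr (Sum.inr ⟨k, hk⟩)⟩

def ccyc (C : Fin m → Fin 3 → Fin n × Bool) (j : Fin m) (s : Fin 9) : GV C :=
  Sum.inr (j, Sum.inl (Sum.inl s))

def cknob (C : Fin m → Fin 3 → Fin n × Bool) (j : Fin m) (t : Fin 3) : GV C :=
  Sum.inr (j, Sum.inl (Sum.inr t))

def cctr (C : Fin m → Fin 3 → Fin n × Bool) (j : Fin m) : GV C := Sum.inr (j, Sum.inr ())

/-- The edges of weight `2.5` inside the variable gadgets: triangle edges, chain edges,
the two pendant edges, and inverter edges. -/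
def varRel (C : Fin m → Fin 3 → Fin n × Bool) (a b : GV C) : Prop :=
  (∃ (i : Fin n) (k : Fin (hocc C i)) (x y : Fin 3),
      x ≠ y ∧ a = vtri C i k x ∧ b = vtri C i k y) ∨
  (∃ (i : Fin n) (k k' : Fin (hocc C i)),
      k'.val = k.val + 1 ∧ a = vtri C i k 1 ∧ b = vtri C i k' 0) ∨
  (∃ (i : Fin n) (k : Fin (hocc C i)), k.val = 0 ∧ a = vpend C i false ∧ b = vtri C i k 0) ∨
  (∃ (i : Fin n) (k : Fin (hocc C i)),
      k.val + 1 = hocc C i ∧ a = vpend C i true ∧ b = vtri C i k 1) ∨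
  (∃ (i : Fin n) (k : Fin (hocc C i))
      (hk : (C ((occs C i).get k).1 ((occs C i).get k).2).2 = false),
      a = vinv C i k hk ∧ b = vtri C i k 2)

/-- The handle edges, of weight `2.5`: knob `c_{j,t}` is attached to cycle vertex `3t`. -/
def handleRel (C : Fin m → Fin 3 → Fin n × Bool) (a b : GV C) : Prop :=
  ∃ (j : Fin m) (t : Fin 3), a = cknob C j t ∧ b = ccyc C j ⟨3 * t.val, by omega⟩

/-- The nonagon edges, of weight `3.6`. -/
def cycleRel (C : Fin m → Fin 3 → Fin n × Bool) (a b : GV C) : Prop :=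
  ∃ (j : Fin m) (s : Fin 9), a = ccyc C j s ∧ b = ccyc C j (s + 1)

/-- The centre edges, of weight `6`. -/
def centreRel (C : Fin m → Fin 3 → Fin n × Bool) (a b : GV C) : Prop :=
  ∃ (j : Fin m) (s : Fin 9), a = cctr C j ∧ b = ccyc C j s

/-- The clause-variable edges, of weight `D`: the knob `c_{j,t}` is joined to the base
vertex of the triangle of the corresponding occurrence of the variable `(C j t).1` if the
literal is positive, and to the inverter of that triangle if the literal is negated. -/
def cvRel (C : Fin m → Fin 3 → Fin n × Bool) (a b : GV C) : Prop :=
  ∃ (j : Fin m) (t : Fin 3) (k : Fin (hocc C (C j t).1)),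
    (occs C (C j t).1).get k = (j, t) ∧ a = cknob C j t ∧
    ((∃ (hk : (C ((occs C (C j t).1).get k).1 ((occs C (C j t).1).get k).2).2 = false),
        b = vinv C (C j t).1 k hk) ∨
      ((C j t).2 = true ∧ b = vtri C (C j t).1 k 2))

/-- The shortcut edges, of weight `2D`: between vertices of different variable gadgets, of
different clause gadgets, or of a variable gadget and a clause gadget not involving that
variable. -/
def shortRel (C : Fin m → Fin 3 → Fin n × Bool) (a b : GV C) : Prop :=
  (∃ (i i' : Fin n) (x : VarV C i) (y : VarV C i'),
      i ≠ i' ∧ a = Sum.inl ⟨i, x⟩ ∧ b = Sum.inl ⟨i', y⟩) ∨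
  (∃ (j j' : Fin m) (x y : ClauseV),
      j ≠ j' ∧ a = Sum.inr (j, x) ∧ b = Sum.inr (j', y)) ∨
  (∃ (i : Fin n) (x : VarV C i) (j : Fin m) (y : ClauseV), (∀ t, (C j t).1 ≠ i) ∧
      a = Sum.inl ⟨i, x⟩ ∧ b = Sum.inr (j, y))

/-- The graph `G_α`. -/
def Galpha (C : Fin m → Fin 3 → Fin n × Bool) : SimpleGraph (GV C) :=
  SimpleGraph.fromRel (fun a b =>
    varRel C a b ∨ handleRel C a b ∨ cycleRel C a b ∨ centreRel C a b ∨
    cvRel C a b ∨ shortRel C a b)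

open Classical in
/-- The weight function of `G_α`, with `D = 5m + 20`. -/
noncomputable def ωα (C : Fin m → Fin 3 → Fin n × Bool) : GV C → GV C → ℝ := fun a b =>
  if varRel C a b ∨ varRel C b a ∨ handleRel C a b ∨ handleRel C b a then 2.5
  else if cycleRel C a b ∨ cycleRel C b a then 3.6
  else if centreRel C a b ∨ centreRel C b a then 6
  else if cvRel C a b ∨ cvRel C b a then 5 * m + 20
  else if shortRel C a b ∨ shortRel C b a then 2 * (5 * m + 20)
  else 0

/-- The assignment `ψ` satisfies the formula: each clause has a true literal. -/
def Satisfies (C : Fin m → Fin 3 → Fin n × Bool) (ψ : Fin n → Bool) : Prop :=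
  ∀ j : Fin m, ∃ t : Fin 3, (if (C j t).2 then ψ (C j t).1 else !(ψ (C j t).1)) = true

/-- Each variable appears at most once per clause. -/
def DistinctVars (C : Fin m → Fin 3 → Fin n × Bool) : Prop :=
  ∀ (j : Fin m) (t t' : Fin 3), (C j t).1 = (C j t').1 → t = t'

section Potentials

variable {V : Type*} {G : SimpleGraph V}

lemma wWeight_nil (w : V → V → ℝ) (u : V) : wWeight w (Walk.nil : G.Walk u u) = 0 := by
  simp [wWeight]

lemma wWeight_cons (w : V → V → ℝ) {u x v : V} (h : G.Adj u x) (p : G.Walk x v) :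
    wWeight w (Walk.cons h p) = w u x + wWeight w p := by
  simp [wWeight]

/-- A potential that increases along every edge by at most its weight bounds the weight of
every walk from below. -/
lemma sub_le_wWeight {w : V → V → ℝ} {f : V → ℝ}
    (hf : ∀ a b, G.Adj a b → f b - f a ≤ w a b) {u v : V} (p : G.Walk u v) :
    f v - f u ≤ wWeight w p := by
  induction p with
  | nil => simp [wWeight_nil]
  | cons h p ih => rw [wWeight_cons]; linarith [hf _ _ h]

lemma wWeight_le_sub {w : V → V → ℝ} {f : V → ℝ} {u v : V} (p : G.Walk u v)
    (hp : ∀ d ∈ p.darts, w d.fst d.snd ≤ f d.snd - f d.fst) :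
    wWeight w p ≤ f v - f u := by
  induction p with
  | nil => simp [wWeight_nil]
  | cons h p ih =>
    simp only [Walk.darts_cons, List.forall_mem_cons] at hp
    rw [wWeight_cons]
    linarith [hp.1, ih hp.2]

lemma isPath_and_le_of_lt {f : V → ℝ} {u v : V} (p : G.Walk u v)
    (hp : ∀ d ∈ p.darts, f d.fst < f d.snd) : p.IsPath ∧ ∀ x ∈ p.support, f u ≤ f x := by
  induction p with
  | nil => simp
  | cons h p ih =>
    simp only [Walk.darts_cons, List.forall_mem_cons] at hp
    obtain ⟨h1, h2⟩ := ih hp.2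
    refine ⟨(Walk.cons_isPath_iff h p).2 ⟨h1, fun hu => ?_⟩, ?_⟩
    · exact absurd (h2 _ hu) (not_le.2 hp.1)
    · simp only [Walk.support_cons, List.forall_mem_cons]
      exact ⟨le_rfl, fun x hx => hp.1.le.trans (h2 x hx)⟩

/-- A potential certifies that a walk of tight edges is a shortest path, so a path-oblivious
rounding is accurate on it. -/
lemma PathObliviousRounding.abs_sub_lt {w : V → V → ℝ} {wt : V → V → ℕ} {ε : ℝ}
    (hr : PathObliviousRounding G w wt ε) {f : V → ℝ}
    (hf : ∀ a b, G.Adj a b → f b - f a ≤ w a b) {u v : V} (p : G.Walk u v)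
    (hp : ∀ d ∈ p.darts, f d.fst < f d.snd ∧ w d.fst d.snd ≤ f d.snd - f d.fst) :
    |wWeight (fun a b => (wt a b : ℝ)) p - (f v - f u)| < ε := by
  have hle := wWeight_le_sub p fun d hd => (hp d hd).2
  have hsp : IsShortestPath w p :=
    ⟨(isPath_and_le_of_lt p fun d hd => (hp d hd).1).1,
      fun q => hle.trans (sub_le_wWeight hf q)⟩
  have := hr u v p hsp
  rwa [hle.antisymm (sub_le_wWeight hf p)] at this

end Potentials

/-! ## Potentials on `G_α` -/

/-- `f` increases along every edge of `G_α` by at most its weight. -/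
def IsPotential (C : Fin m → Fin 3 → Fin n × Bool) (f : GV C → ℝ) : Prop :=
  ∀ a b, (Galpha C).Adj a b → f b - f a ≤ ωα C a b

/-- An edge of `G_α` along which `f` increases by at least the weight. -/
structure IsTight (C : Fin m → Fin 3 → Fin n × Bool) (f : GV C → ℝ) (a b : GV C) : Prop where
  adj : (Galpha C).Adj a b
  lt : f a < f b
  le : ωα C a b ≤ f b - f a

section Certificates

variable {C : Fin m → Fin 3 → Fin n × Bool} {f : GV C → ℝ}

lemma isPotential_of_rel
    (hvar : ∀ a b, varRel C a b → |f a - f b| ≤ 2.5)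
    (hhandle : ∀ a b, handleRel C a b → |f a - f b| ≤ 2.5)
    (hcycle : ∀ a b, cycleRel C a b → |f a - f b| ≤ 3.6)
    (hcentre : ∀ a b, centreRel C a b → |f a - f b| ≤ 6)
    (hcv : ∀ a b, cvRel C a b → |f a - f b| ≤ 5 * m + 20)
    (hshort : ∀ a b, shortRel C a b → |f a - f b| ≤ 2 * (5 * m + 20)) :
    IsPotential C f := by
  intro a b hab
  simp only [Galpha, fromRel_adj] at hab
  unfold ωα
  split_ifs with h1 h2 h3 h4 h5
  · rcases h1 with h | h | h | h
    · linarith [(abs_le.1 (hvar _ _ h)).1]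
    · linarith [(abs_le.1 (hvar _ _ h)).2]
    · linarith [(abs_le.1 (hhandle _ _ h)).1]
    · linarith [(abs_le.1 (hhandle _ _ h)).2]
  · rcases h2 with h | h
    · linarith [(abs_le.1 (hcycle _ _ h)).1]
    · linarith [(abs_le.1 (hcycle _ _ h)).2]
  · rcases h3 with h | h
    · linarith [(abs_le.1 (hcentre _ _ h)).1]
    · linarith [(abs_le.1 (hcentre _ _ h)).2]
  · rcases h4 with h | h
    · linarith [(abs_le.1 (hcv _ _ h)).1]
    · linarith [(abs_le.1 (hcv _ _ h)).2]
  · rcases h5 with h | h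
    · linarith [(abs_le.1 (hshort _ _ h)).1]
    · linarith [(abs_le.1 (hshort _ _ h)).2]
  · tauto

lemma IsTight.of_ne {a b : GV C} (h : f a < f b)
    (hrel : (varRel C a b ∨ handleRel C a b ∨ cycleRel C a b ∨ centreRel C a b ∨
      cvRel C a b ∨ shortRel C a b) ∨ varRel C b a ∨ handleRel C b a ∨ cycleRel C b a ∨
      centreRel C b a ∨ cvRel C b a ∨ shortRel C b a)
    (hle : ωα C a b ≤ f b - f a) : IsTight C f a b where
  adj := by
    simp only [Galpha, fromRel_adj]
    exact ⟨fun hab => h.ne (congrArg f hab), hrel⟩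
  lt := h
  le := hle

lemma IsTight.of_light {a b : GV C}
    (hrel : varRel C a b ∨ varRel C b a ∨ handleRel C a b ∨ handleRel C b a)
    (hf : f b - f a = 2.5) : IsTight C f a b := by
  refine .of_ne (by norm_num at hf; linarith) (by tauto) ?_
  rw [ωα, if_pos hrel, hf]

lemma IsTight.of_cycle {a b : GV C} (hrel : cycleRel C a b ∨ cycleRel C b a)
    (hf : f b - f a = 3.6) : IsTight C f a b := by
  refine .of_ne (by norm_num at hf; linarith) (by tauto) ?_
  rw [ωα, hf, if_pos hrel]
  split_ifs <;> norm_num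

lemma IsTight.of_cv {a b : GV C} (hrel : cvRel C b a)
    (hf : f b - f a = 5 * m + 20) : IsTight C f a b := by
  have hm : (0 : ℝ) ≤ m := m.cast_nonneg
  refine .of_ne (by linarith) (by tauto) ?_
  rw [ωα, hf, if_pos (c := cvRel C a b ∨ cvRel C b a) (.inr hrel)]
  split_ifs <;> norm_num <;> linarith

lemma IsTight.abs_wt_sub_lt {wt : GV C → GV C → ℕ}
    (hround : PathObliviousRounding (Galpha C) (ωα C) wt 1) (hf : IsPotential C f)
    {a b : GV C} (h : IsTight C f a b) : |(wt a b : ℝ) - (f b - f a)| < 1 := by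
  have := hround.abs_sub_lt hf (.cons h.adj .nil)
    (by simp only [Walk.darts_cons, Walk.darts_nil, List.forall_mem_cons]
        exact ⟨⟨h.lt, h.le⟩, by simp⟩)
  simpa only [wWeight_cons, wWeight_nil, add_zero] using this

lemma IsTight.abs_wt_sub_lt₂ {wt : GV C → GV C → ℕ}
    (hround : PathObliviousRounding (Galpha C) (ωα C) wt 1) (hf : IsPotential C f)
    {a b c : GV C} (h₁ : IsTight C f a b) (h₂ : IsTight C f b c) :
    |(wt a b + wt b c : ℝ) - (f c - f a)| < 1 := by
  have := hround.abs_sub_lt hf (.cons h₁.adj (.cons h₂.adj .nil))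
    (by simp only [Walk.darts_cons, Walk.darts_nil, List.forall_mem_cons]
        exact ⟨⟨h₁.lt, h₁.le⟩, ⟨h₂.lt, h₂.le⟩, by simp⟩)
  simpa only [wWeight_cons, wWeight_nil, add_zero] using this

lemma IsTight.abs_wt_sub_lt₃ {wt : GV C → GV C → ℕ}
    (hround : PathObliviousRounding (Galpha C) (ωα C) wt 1) (hf : IsPotential C f)
    {a b c d : GV C} (h₁ : IsTight C f a b) (h₂ : IsTight C f b c) (h₃ : IsTight C f c d) :
    |(wt a b + (wt b c + wt c d) : ℝ) - (f d - f a)| < 1 := by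
  have := hround.abs_sub_lt hf (.cons h₁.adj (.cons h₂.adj (.cons h₃.adj .nil)))
    (by simp only [Walk.darts_cons, Walk.darts_nil, List.forall_mem_cons]
        exact ⟨⟨h₁.lt, h₁.le⟩, ⟨h₂.lt, h₂.le⟩, ⟨h₃.lt, h₃.le⟩, by simp⟩)
  simpa only [wWeight_cons, wWeight_nil, add_zero] using this

lemma IsTight.abs_wt_sub_lt₅ {wt : GV C → GV C → ℕ}
    (hround : PathObliviousRounding (Galpha C) (ωα C) wt 1) (hf : IsPotential C f)
    {a b c d e g : GV C} (h₁ : IsTight C f a b) (h₂ : IsTight C f b c) (h₃ : IsTight C f c d)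
    (h₄ : IsTight C f d e) (h₅ : IsTight C f e g) :
    |(wt a b + (wt b c + (wt c d + (wt d e + wt e g))) : ℝ) - (f g - f a)| < 1 := by
  have := hround.abs_sub_lt hf
    (.cons h₁.adj (.cons h₂.adj (.cons h₃.adj (.cons h₄.adj (.cons h₅.adj .nil)))))
    (by simp only [Walk.darts_cons, Walk.darts_nil, List.forall_mem_cons]
        exact ⟨⟨h₁.lt, h₁.le⟩, ⟨h₂.lt, h₂.le⟩, ⟨h₃.lt, h₃.le⟩, ⟨h₄.lt, h₄.le⟩,
          ⟨h₅.lt, h₅.le⟩, by simp⟩)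
  simpa only [wWeight_cons, wWeight_nil, add_zero] using this

end Certificates

/-! ## Variable gadgets -/

open Classical in
/-- The potential that is `0` at the variable-gadget vertex `u`, `5` at the variable-gadget
vertex `v`, and `2.5` elsewhere. -/
noncomputable def pairPotential (C : Fin m → Fin 3 → Fin n × Bool) (u v : Σ i, VarV C i) :
    GV C → ℝ :=
  Sum.elim (fun x => if x = u then 0 else if x = v then 5 else 2.5) (fun _ => 2.5)

section VariableGadget

variable {C : Fin m → Fin 3 → Fin n × Bool}

lemma pairPotential_mem (u v : Σ i, VarV C i) (a : GV C) :
    0 ≤ pairPotential C u v a ∧ pairPotential C u v a ≤ 5 := by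
  rcases a with x | q
  · simp only [pairPotential, Sum.elim_inl]
    split_ifs <;> norm_num
  · simp only [pairPotential, Sum.elim_inr]
    norm_num

lemma isPotential_pairPotential {u v : Σ i, VarV C i}
    (h : ¬ varRel C (Sum.inl u) (Sum.inl v)) (h' : ¬ varRel C (Sum.inl v) (Sum.inl u)) :
    IsPotential C (pairPotential C u v) := by
  have hm : (0 : ℝ) ≤ m := m.cast_nonneg
  have h5 (a b : GV C) : |pairPotential C u v a - pairPotential C u v b| ≤ 5 := by
    have ha := pairPotential_mem u v a
    have hb := pairPotential_mem u v b
    rw [abs_le]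
    constructor <;> linarith
  refine isPotential_of_rel ?_ ?_ ?_ (fun a b _ => (h5 a b).trans (by norm_num))
    (fun a b _ => (h5 a b).trans (by linarith)) (fun a b _ => (h5 a b).trans (by linarith))
  · rintro (a | a) (b | b) hab
    · simp only [pairPotential, Sum.elim_inl]
      split_ifs <;> subst_vars <;> first | contradiction | norm_num [abs_le]
    · simp only [pairPotential, Sum.elim_inl, Sum.elim_inr]
      split_ifs <;> norm_num [abs_le]
    · simp only [pairPotential, Sum.elim_inl, Sum.elim_inr]
      split_ifs <;> norm_num [abs_le]
    · simp [pairPotential]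
      norm_num
  · rintro _ _ ⟨j, t, rfl, rfl⟩
    simp [pairPotential, cknob, ccyc]
    norm_num
  · rintro _ _ ⟨j, s, rfl, rfl⟩
    simp [pairPotential, ccyc]
    norm_num

/-- Two consecutive edges of a variable gadget whose ends are not adjacent are rounded in
opposite directions. -/
lemma wt_add_wt_eq_five {wt : GV C → GV C → ℕ}
    (hround : PathObliviousRounding (Galpha C) (ωα C) wt 1) {u x v : Σ i, VarV C i}
    (hux : varRel C (Sum.inl u) (Sum.inl x) ∨ varRel C (Sum.inl x) (Sum.inl u))
    (hxv : varRel C (Sum.inl x) (Sum.inl v) ∨ varRel C (Sum.inl v) (Sum.inl x))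
    (hxu : x ≠ u) (hxv' : x ≠ v) (huv : v ≠ u)
    (h : ¬ varRel C (Sum.inl u) (Sum.inl v)) (h' : ¬ varRel C (Sum.inl v) (Sum.inl u)) :
    wt (Sum.inl u) (Sum.inl x) + wt (Sum.inl x) (Sum.inl v) = 5 ∧
      (wt (Sum.inl u) (Sum.inl x) = 2 ∨ wt (Sum.inl u) (Sum.inl x) = 3) := by
  have hf := isPotential_pairPotential h h'
  have hu : pairPotential C u v (Sum.inl u) = 0 := by simp [pairPotential]
  have hx : pairPotential C u v (Sum.inl x) = 2.5 := by simp [pairPotential, hxu, hxv']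
  have hv : pairPotential C u v (Sum.inl v) = 5 := by simp [pairPotential, huv]
  have h₁ : IsTight C (pairPotential C u v) (Sum.inl u) (Sum.inl x) :=
    .of_light (by tauto) (by rw [hu, hx]; norm_num)
  have h₂ : IsTight C (pairPotential C u v) (Sum.inl x) (Sum.inl v) :=
    .of_light (by tauto) (by rw [hv, hx]; norm_num)
  have e₁ := abs_lt.1 (h₁.abs_wt_sub_lt hround hf)
  have e₂ := abs_lt.1 (h₁.abs_wt_sub_lt₂ hround hf h₂)
  rw [hu, hx] at e₁
  rw [hu, hv] at e₂
  norm_num at e₁ e₂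
  obtain ⟨a₁, a₂⟩ := e₁
  obtain ⟨a₃, a₄⟩ := e₂
  generalize wt (Sum.inl u) (Sum.inl x) = p at *
  generalize wt (Sum.inl x) (Sum.inl v) = q at *
  have b₁ : p < 4 := by exact_mod_cast (by linarith : (p : ℝ) < 4)
  have b₂ : 1 < p := by exact_mod_cast (by linarith : (1 : ℝ) < p)
  have b₃ : p + q < 6 := by exact_mod_cast (by linarith : (p + q : ℝ) < 6)
  have b₄ : 4 < p + q := by exact_mod_cast (by linarith : (4 : ℝ) < p + q)
  omega

lemma varRel_tri (i : Fin n) (k : Fin (hocc C i)) {x y : Fin 3} (h : x ≠ y) :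
    varRel C (vtri C i k x) (vtri C i k y) := .inl ⟨i, k, x, y, h, rfl, rfl⟩

lemma varRel_chain (i : Fin n) {k k' : Fin (hocc C i)} (h : k'.val = k.val + 1) :
    varRel C (vtri C i k 1) (vtri C i k' 0) := .inr (.inl ⟨i, k, k', h, rfl, rfl⟩)

lemma varRel_pend (i : Fin n) {k : Fin (hocc C i)} (h : k.val = 0) :
    varRel C (vpend C i false) (vtri C i k 0) := .inr (.inr (.inl ⟨i, k, h, rfl, rfl⟩))

lemma varRel_inv (i : Fin n) (k : Fin (hocc C i))
    (hk : (C ((occs C i).get k).1 ((occs C i).get k).2).2 = false) :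
    varRel C (vinv C i k hk) (vtri C i k 2) :=
  .inr (.inr (.inr (.inr ⟨i, k, hk, rfl, rfl⟩)))

lemma vtri_inj {i i' : Fin n} {k : Fin (hocc C i)} {k' : Fin (hocc C i')} {x y : Fin 3} :
    vtri C i k x = vtri C i' k' y ↔ i = i' ∧ k.val = k'.val ∧ x = y := by
  constructor
  · intro h
    cases h
    simp
  · rintro ⟨rfl, hk, rfl⟩
    rw [Fin.ext hk]

lemma vtri_ne_vpend (i i' : Fin n) (k : Fin (hocc C i)) (x : Fin 3) (b : Bool) :
    vtri C i k x ≠ vpend C i' b := by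
  rintro ⟨⟩

lemma vtri_ne_vinv (i i' : Fin n) (k : Fin (hocc C i)) (x : Fin 3) (k' : Fin (hocc C i'))
    (hk : (C ((occs C i').get k').1 ((occs C i').get k').2).2 = false) :
    vtri C i k x ≠ vinv C i' k' hk := by
  rintro ⟨⟩

lemma vpend_inj {i i' : Fin n} {b b' : Bool} :
    vpend C i b = vpend C i' b' ↔ i = i' ∧ b = b' := by
  constructor
  · intro h
    cases h
    simp
  · rintro ⟨rfl, rfl⟩
    rfl

lemma vpend_ne_vinv (i i' : Fin n) (b : Bool) (k' : Fin (hocc C i'))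
    (hk : (C ((occs C i').get k').1 ((occs C i').get k').2).2 = false) :
    vpend C i b ≠ vinv C i' k' hk := by
  rintro ⟨⟩

/-- Distinct triangles are joined only from a right vertex to the next left vertex. -/
lemma varRel_tri_tri {i : Fin n} {k k' : Fin (hocc C i)} {x y : Fin 3}
    (h : varRel C (vtri C i k x) (vtri C i k' y)) :
    k = k' ∨ (x = 1 ∧ y = 0) := by
  rcases h with ⟨i₁, k₁, x₁, y₁, hne, ha, hb⟩ | ⟨i₁, k₁, k₂, hk, ha, hb⟩ |
    ⟨i₁, k₁, hk, ha, hb⟩ | ⟨i₁, k₁, hk, ha, hb⟩ | ⟨i₁, k₁, hk, ha, hb⟩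
  · rw [vtri_inj] at ha hb
    left
    ext
    omega
  · rw [vtri_inj] at ha hb
    exact .inr ⟨ha.2.2, hb.2.2⟩
  · exact (vtri_ne_vpend _ _ _ _ _ ha).elim
  · exact (vtri_ne_vpend _ _ _ _ _ ha).elim
  · exact (vtri_ne_vinv _ _ _ _ _ _ ha).elim

lemma not_varRel_vpend (a : GV C) (i : Fin n) (b : Bool) : ¬ varRel C a (vpend C i b) := by
  rintro (⟨i₁, k₁, x₁, y₁, hne, ha, hb⟩ | ⟨i₁, k₁, k₂, hk, ha, hb⟩ |
    ⟨i₁, k₁, hk, ha, hb⟩ | ⟨i₁, k₁, hk, ha, hb⟩ | ⟨i₁, k₁, hk, ha, hb⟩) <;>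
  exact vtri_ne_vpend _ _ _ _ _ hb.symm

lemma not_varRel_vinv (a : GV C) (i : Fin n) (k : Fin (hocc C i))
    (hk : (C ((occs C i).get k).1 ((occs C i).get k).2).2 = false) :
    ¬ varRel C a (vinv C i k hk) := by
  rintro (⟨i₁, k₁, x₁, y₁, hne, ha, hb⟩ | ⟨i₁, k₁, k₂, hk, ha, hb⟩ |
    ⟨i₁, k₁, hk, ha, hb⟩ | ⟨i₁, k₁, hk, ha, hb⟩ | ⟨i₁, k₁, hk, ha, hb⟩) <;>
  exact vtri_ne_vinv _ _ _ _ _ _ hb.symm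

lemma eq_zero_of_varRel_vpend_false {i : Fin n} {k : Fin (hocc C i)} {x : Fin 3}
    (h : varRel C (vpend C i false) (vtri C i k x)) : x = 0 := by
  rcases h with ⟨i₁, k₁, x₁, y₁, hne, ha, hb⟩ | ⟨i₁, k₁, k₂, hk, ha, hb⟩ |
    ⟨i₁, k₁, hk, ha, hb⟩ | ⟨i₁, k₁, hk, ha, hb⟩ | ⟨i₁, k₁, hk, ha, hb⟩
  · exact (vtri_ne_vpend _ _ _ _ _ ha.symm).elim
  · exact (vtri_ne_vpend _ _ _ _ _ ha.symm).elim
  · exact (vtri_inj.1 hb).2.2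
  · simp [vpend_inj] at ha
  · exact (vpend_ne_vinv _ _ _ _ _ ha).elim

lemma eq_two_of_varRel_vinv {i : Fin n} {k k' : Fin (hocc C i)} {x : Fin 3}
    {hk : (C ((occs C i).get k).1 ((occs C i).get k).2).2 = false}
    (h : varRel C (vinv C i k hk) (vtri C i k' x)) : x = 2 := by
  rcases h with ⟨i₁, k₁, x₁, y₁, hne, ha, hb⟩ | ⟨i₁, k₁, k₂, hk, ha, hb⟩ |
    ⟨i₁, k₁, hk, ha, hb⟩ | ⟨i₁, k₁, hk, ha, hb⟩ | ⟨i₁, k₁, hk, ha, hb⟩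
  · exact (vtri_ne_vinv _ _ _ _ _ _ ha.symm).elim
  · exact (vtri_ne_vinv _ _ _ _ _ _ ha.symm).elim
  · exact (vpend_ne_vinv _ _ _ _ _ ha.symm).elim
  · exact (vpend_ne_vinv _ _ _ _ _ ha.symm).elim
  · exact (vtri_inj.1 hb).2.2

lemma wt_pend_eq {wt : GV C → GV C → ℕ}
    (hround : PathObliviousRounding (Galpha C) (ωα C) wt 1) (i : Fin n)
    {k : Fin (hocc C i)} (hk : k.val = 0) {x : Fin 3} (hx : x ≠ 0) :
    wt (vpend C i false) (vtri C i k 0) + wt (vtri C i k 0) (vtri C i k x) = 5 ∧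
      (wt (vpend C i false) (vtri C i k 0) = 2 ∨ wt (vpend C i false) (vtri C i k 0) = 3) := by
  refine wt_add_wt_eq_five hround (u := ⟨i, Sum.inr (Sum.inl false)⟩) (x := ⟨i, Sum.inl (k, 0)⟩)
    (v := ⟨i, Sum.inl (k, x)⟩) (.inl (varRel_pend i hk)) (.inl (varRel_tri i k hx.symm))
    ?_ ?_ ?_ ?_ ?_
  · rintro ⟨⟩
  · rintro ⟨⟩
    exact hx rfl
  · rintro ⟨⟩
  · exact fun h => hx (eq_zero_of_varRel_vpend_false h)
  · exact not_varRel_vpend _ _ _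

lemma wt_tri_chain {wt : GV C → GV C → ℕ}
    (hround : PathObliviousRounding (Galpha C) (ωα C) wt 1) (i : Fin n)
    {k k' : Fin (hocc C i)} (hk : k'.val = k.val + 1) :
    wt (vtri C i k 0) (vtri C i k 1) + wt (vtri C i k 1) (vtri C i k' 0) = 5 := by
  have hne : k ≠ k' := by
    rintro rfl
    omega
  refine (wt_add_wt_eq_five hround (u := ⟨i, Sum.inl (k, 0)⟩) (x := ⟨i, Sum.inl (k, 1)⟩)
    (v := ⟨i, Sum.inl (k', 0)⟩) (.inl (varRel_tri i k (by decide))) (.inl (varRel_chain i hk))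
    ?_ ?_ ?_ ?_ ?_).1
  · rintro ⟨⟩
  · rintro ⟨⟩
  · rintro ⟨⟩
    exact hne rfl
  · exact fun h => (varRel_tri_tri h).elim hne (by simp)
  · exact fun h => (varRel_tri_tri h).elim hne.symm (by simp)

lemma wt_chain_tri {wt : GV C → GV C → ℕ}
    (hround : PathObliviousRounding (Galpha C) (ωα C) wt 1) (i : Fin n)
    {k k' : Fin (hocc C i)} (hk : k'.val = k.val + 1) {x : Fin 3} (hx : x ≠ 0) :
    wt (vtri C i k 1) (vtri C i k' 0) + wt (vtri C i k' 0) (vtri C i k' x) = 5 := by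
  have hne : k ≠ k' := by
    rintro rfl
    omega
  refine (wt_add_wt_eq_five hround (u := ⟨i, Sum.inl (k, 1)⟩) (x := ⟨i, Sum.inl (k', 0)⟩)
    (v := ⟨i, Sum.inl (k', x)⟩) (.inl (varRel_chain i hk)) (.inl (varRel_tri i k' hx.symm))
    ?_ ?_ ?_ ?_ ?_).1
  · rintro ⟨⟩
  · rintro ⟨⟩
    exact hx rfl
  · rintro ⟨⟩
    exact hne rfl
  · exact fun h => (varRel_tri_tri h).elim hne (by simp [hx])
  · exact fun h => (varRel_tri_tri h).elim hne.symm (by simp)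

lemma wt_tri_inv {wt : GV C → GV C → ℕ}
    (hround : PathObliviousRounding (Galpha C) (ωα C) wt 1) (i : Fin n) (k : Fin (hocc C i))
    (hk : (C ((occs C i).get k).1 ((occs C i).get k).2).2 = false) :
    wt (vtri C i k 0) (vtri C i k 2) + wt (vtri C i k 2) (vinv C i k hk) = 5 := by
  refine (wt_add_wt_eq_five hround (u := ⟨i, Sum.inl (k, 0)⟩) (x := ⟨i, Sum.inl (k, 2)⟩)
    (v := ⟨i, Sum.inr (Sum.inr ⟨k, hk⟩)⟩) (.inl (varRel_tri i k (by decide)))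
    (.inr (varRel_inv i k hk)) ?_ ?_ ?_ ?_ ?_).1
  · rintro ⟨⟩
  · rintro ⟨⟩
  · rintro ⟨⟩
  · exact not_varRel_vinv _ _ _ _
  · exact fun h => absurd (eq_two_of_varRel_vinv h) (by decide)

/-- In every triangle the two edges at the left vertex are rounded opposite to the first
pendant edge. -/
lemma wt_pend_add_wt_tri {wt : GV C → GV C → ℕ}
    (hround : PathObliviousRounding (Galpha C) (ωα C) wt 1) (i : Fin n) (h : 0 < hocc C i)
    (k : ℕ) (hk : k < hocc C i) {x : Fin 3} (hx : x ≠ 0) :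
    wt (vpend C i false) (vtri C i ⟨0, h⟩ 0) + wt (vtri C i ⟨k, hk⟩ 0) (vtri C i ⟨k, hk⟩ x)
      = 5 := by
  induction k generalizing x with
  | zero => exact (wt_pend_eq hround i rfl hx).1
  | succ k ih =>
    have h₁ := ih (by omega) (x := 1) (by decide)
    have h₂ := wt_tri_chain hround i (k := ⟨k, by omega⟩) (k' := ⟨k + 1, hk⟩) rfl
    have h₃ := wt_chain_tri hround i (k := ⟨k, by omega⟩) (k' := ⟨k + 1, hk⟩) rfl hx
    omega

end VariableGadget

/-! ## Connections between variable gadgets and clause gadgets -/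

section Connection

variable {C : Fin m → Fin 3 → Fin n × Bool}

lemma exists_occs_get_eq (C : Fin m → Fin 3 → Fin n × Bool) (j : Fin m) (t : Fin 3) :
    ∃ k : Fin (hocc C (C j t).1), (occs C (C j t).1).get k = (j, t) := by
  have hmem : (j, t) ∈ occs C (C j t).1 := by
    simp [occs, List.product]
  exact List.get_of_mem hmem

lemma occs_nodup (C : Fin m → Fin 3 → Fin n × Bool) (i : Fin n) : (occs C i).Nodup :=
  ((List.nodup_finRange m).product (List.nodup_finRange 3)).filter _

lemma cvRel_cknob_unique {j : Fin m} {t : Fin 3} {b b' : GV C}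
    (h : cvRel C (cknob C j t) b) (h' : cvRel C (cknob C j t) b') : b = b' := by
  obtain ⟨j₁, t₁, k₁, hk₁, ha₁, hb₁⟩ := h
  obtain ⟨j₂, t₂, k₂, hk₂, ha₂, hb₂⟩ := h'
  cases ha₁
  cases ha₂
  obtain rfl : k₁ = k₂ := (occs_nodup C _).injective_get (hk₁.trans hk₂.symm)
  rcases hb₁ with ⟨hn₁, rfl⟩ | ⟨hp₁, rfl⟩ <;> rcases hb₂ with ⟨hn₂, rfl⟩ | ⟨hp₂, rfl⟩
  · rfl
  · rw [hk₁] at hn₁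
    simp_all
  · rw [hk₁] at hn₂
    simp_all
  · rfl

open Classical in
/-- The potential for the shortest paths from the gadget of `x_i` through its vertex `v` and
the knob `c_{j,t}` into the gadget of `C_j`. -/
noncomputable def connectionPotential (C : Fin m → Fin 3 → Fin n × Bool) (j : Fin m) (t : Fin 3)
    (v : VarV C (C j t).1) : GV C → ℝ :=
  Sum.elim
    (fun x => if x = ⟨(C j t).1, v⟩ then 2.5 else if x.1 = (C j t).1 then 0 else 5 * m + 20)
    (fun q => if q.1 = j then Sum.elim (Sum.elim (fun _ => 5 * m + 25)
      (fun t' => if t' = t then 5 * m + 22.5 else 5 * m + 25)) (fun _ => 5 * m + 25) q.2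
      else 5 * m + 20)

lemma connectionPotential_inl_of_eq (j : Fin m) (t : Fin 3) (v : VarV C (C j t).1) :
    connectionPotential C j t v (Sum.inl ⟨_, v⟩) = 2.5 := by
  simp [connectionPotential]

lemma connectionPotential_inl_of_ne (j : Fin m) (t : Fin 3) {u v : VarV C (C j t).1}
    (h : u ≠ v) : connectionPotential C j t v (Sum.inl ⟨_, u⟩) = 0 := by
  simp [connectionPotential, h]

lemma connectionPotential_inl_of_fst_ne (j : Fin m) (t : Fin 3) (v : VarV C (C j t).1)
    {x : Σ i, VarV C i} (h : x.1 ≠ (C j t).1) :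
    connectionPotential C j t v (Sum.inl x) = 5 * m + 20 := by
  have : x ≠ ⟨(C j t).1, v⟩ := fun e => h (congrArg Sigma.fst e)
  simp [connectionPotential, h, this]

lemma connectionPotential_cknob (j : Fin m) (t : Fin 3) (v : VarV C (C j t).1) :
    connectionPotential C j t v (cknob C j t) = 5 * m + 22.5 := by
  simp [connectionPotential, cknob]

lemma connectionPotential_ccyc (j : Fin m) (t : Fin 3) (v : VarV C (C j t).1) (s : Fin 9) :
    connectionPotential C j t v (ccyc C j s) = 5 * m + 25 := by
  simp [connectionPotential, ccyc]

lemma connectionPotential_inr_of_ne (j : Fin m) (t : Fin 3) (v : VarV C (C j t).1)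
    {q : Fin m × ClauseV} (h : q.1 ≠ j) :
    connectionPotential C j t v (Sum.inr q) = 5 * m + 20 := by
  simp [connectionPotential, h]

lemma connectionPotential_inr_mem (j : Fin m) (t : Fin 3) (v : VarV C (C j t).1)
    (y : ClauseV) : 5 * m + 22.5 ≤ connectionPotential C j t v (Sum.inr (j, y)) ∧
      connectionPotential C j t v (Sum.inr (j, y)) ≤ 5 * m + 25 := by
  rcases y with (s | t') | _
  · simp [connectionPotential]
    norm_num
  · simp only [connectionPotential, Sum.elim_inr, Sum.elim_inl, if_pos]
    split_ifs <;> norm_num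
  · simp [connectionPotential]
    norm_num

lemma connectionPotential_inl_mem (j : Fin m) (t : Fin 3) (v : VarV C (C j t).1)
    (y : VarV C (C j t).1) : 0 ≤ connectionPotential C j t v (Sum.inl ⟨_, y⟩) ∧
      connectionPotential C j t v (Sum.inl ⟨_, y⟩) ≤ 2.5 := by
  by_cases h : y = v
  · rw [h, connectionPotential_inl_of_eq]
    norm_num
  · rw [connectionPotential_inl_of_ne _ _ h]
    norm_num

lemma isPotential_connectionPotential (hdist : DistinctVars C) {j : Fin m} {t : Fin 3}
    {v : VarV C (C j t).1} (hv : cvRel C (cknob C j t) (Sum.inl ⟨(C j t).1, v⟩)) :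
    IsPotential C (connectionPotential C j t v) := by
  have hm : (1 : ℝ) ≤ m := by exact_mod_cast j.pos
  have hgad (i : Fin n) (x y : VarV C i) :
      |connectionPotential C j t v (Sum.inl ⟨i, x⟩) -
        connectionPotential C j t v (Sum.inl ⟨i, y⟩)| ≤ 2.5 := by
    rw [abs_le]
    by_cases h : i = (C j t).1
    · subst h
      have hx := connectionPotential_inl_mem j t v x
      have hy := connectionPotential_inl_mem j t v y
      constructor <;> linarith
    · rw [connectionPotential_inl_of_fst_ne _ _ _ h, connectionPotential_inl_of_fst_ne _ _ _ h]
      norm_num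
  have hcl (j' : Fin m) (y z : ClauseV) :
      |connectionPotential C j t v (Sum.inr (j', y)) -
        connectionPotential C j t v (Sum.inr (j', z))| ≤ 2.5 := by
    rw [abs_le]
    by_cases h : j' = j
    · subst h
      have hy := connectionPotential_inr_mem j' t v y
      have hz := connectionPotential_inr_mem j' t v z
      constructor <;> linarith
    · rw [connectionPotential_inr_of_ne _ _ _ h, connectionPotential_inr_of_ne _ _ _ h]
      norm_num
  have hinl (x : Σ i, VarV C i) : 0 ≤ connectionPotential C j t v (Sum.inl x) ∧
      connectionPotential C j t v (Sum.inl x) ≤ 5 * m + 20 := by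
    obtain ⟨i, x⟩ := x
    by_cases h : i = (C j t).1
    · subst h
      have hx := connectionPotential_inl_mem j t v x
      constructor <;> linarith
    · rw [connectionPotential_inl_of_fst_ne _ _ _ h]
      constructor <;> linarith
  have hinr (q : Fin m × ClauseV) : 5 * m + 20 ≤ connectionPotential C j t v (Sum.inr q) ∧
      connectionPotential C j t v (Sum.inr q) ≤ 5 * m + 25 := by
    obtain ⟨j', y⟩ := q
    by_cases h : j' = j
    · subst h
      have hy := connectionPotential_inr_mem j' t v y
      constructor <;> linarith
    · rw [connectionPotential_inr_of_ne _ _ _ h]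
      constructor <;> linarith
  have hrange (a : GV C) : 0 ≤ connectionPotential C j t v a ∧
      connectionPotential C j t v a ≤ 5 * m + 25 := by
    rcases a with x | q
    · have := hinl x
      constructor <;> linarith
    · have := hinr q
      constructor <;> linarith
  refine isPotential_of_rel ?_ ?_ ?_ ?_ ?_ ?_
  · rintro _ _ (⟨i₁, k₁, x₁, y₁, hne, rfl, rfl⟩ | ⟨i₁, k₁, k₂, hk, rfl, rfl⟩ |
      ⟨i₁, k₁, hk, rfl, rfl⟩ | ⟨i₁, k₁, hk, rfl, rfl⟩ | ⟨i₁, k₁, hk, rfl, rfl⟩) <;>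
    exact hgad _ _ _
  · rintro _ _ ⟨j, t, rfl, rfl⟩
    exact hcl _ _ _
  · rintro _ _ ⟨j, t, rfl, rfl⟩
    exact (hcl _ _ _).trans (by norm_num)
  · rintro _ _ ⟨j, t, rfl, rfl⟩
    exact (hcl _ _ _).trans (by norm_num)
  · intro a b hab
    obtain ⟨j', t', k', hk', rfl, hb⟩ := id hab
    obtain ⟨y, rfl⟩ : ∃ y : VarV C (C j' t').1, b = Sum.inl ⟨_, y⟩ := by
      rcases hb with ⟨_, rfl⟩ | ⟨_, rfl⟩
      · exact ⟨_, rfl⟩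
      · exact ⟨_, rfl⟩
    rw [abs_le]
    by_cases hj : j' = j
    · subst hj
      by_cases ht : (C j' t').1 = (C j' t).1
      · obtain rfl := hdist _ _ _ ht
        rw [cvRel_cknob_unique hab hv, connectionPotential_cknob, connectionPotential_inl_of_eq]
        constructor <;> linarith
      · have hy := connectionPotential_inr_mem j' t v (Sum.inl (Sum.inr t'))
        rw [connectionPotential_inl_of_fst_ne _ _ _ ht, cknob]
        constructor <;> linarith
    · have hy := hinl ⟨_, y⟩
      rw [cknob, connectionPotential_inr_of_ne _ _ _ hj]
      constructor <;> linarith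
  · intro a b _
    rw [abs_le]
    constructor <;> linarith [(hrange a).1, (hrange a).2, (hrange b).1, (hrange b).2]

/-- The handle edge at `c_{j,t}` is rounded opposite to any edge of the variable gadget at the
vertex `v` to which `c_{j,t}` is joined. -/
lemma wt_add_wt_handle {wt : GV C → GV C → ℕ}
    (hround : PathObliviousRounding (Galpha C) (ωα C) wt 1) (hdist : DistinctVars C)
    {j : Fin m} {t : Fin 3} {u v : VarV C (C j t).1}
    (hv : cvRel C (cknob C j t) (Sum.inl ⟨(C j t).1, v⟩)) (huv : u ≠ v)
    (hrel : varRel C (Sum.inl ⟨_, u⟩) (Sum.inl ⟨_, v⟩) ∨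
      varRel C (Sum.inl ⟨_, v⟩) (Sum.inl ⟨_, u⟩)) :
    wt (Sum.inl ⟨_, u⟩) (Sum.inl ⟨_, v⟩) +
      wt (cknob C j t) (ccyc C j ⟨3 * t.val, by omega⟩) = 5 := by
  have hf := isPotential_connectionPotential hdist hv
  have e₁ := connectionPotential_inl_of_ne j t huv
  have e₂ := connectionPotential_inl_of_eq j t v
  have e₃ := connectionPotential_cknob j t v
  have e₄ := connectionPotential_ccyc j t v ⟨3 * t.val, by omega⟩
  have h₁ : IsTight C (connectionPotential C j t v) (Sum.inl ⟨_, u⟩) (Sum.inl ⟨_, v⟩) :=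
    .of_light (by tauto) (by rw [e₁, e₂]; norm_num)
  have h₂ : IsTight C (connectionPotential C j t v) (Sum.inl ⟨_, v⟩) (cknob C j t) :=
    .of_cv hv (by rw [e₂, e₃]; ring)
  have h₃ : IsTight C (connectionPotential C j t v) (cknob C j t)
      (ccyc C j ⟨3 * t.val, by omega⟩) :=
    .of_light (.inr (.inr (.inl ⟨j, t, rfl, rfl⟩))) (by rw [e₃, e₄]; ring)
  have b₁ := abs_lt.1 (h₂.abs_wt_sub_lt hround hf)
  have b₂ := abs_lt.1 (h₁.abs_wt_sub_lt₃ hround hf h₂ h₃)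
  rw [e₂, e₃] at b₁
  rw [e₁, e₄] at b₂
  obtain ⟨a₁, a₂⟩ := b₁
  obtain ⟨a₃, a₄⟩ := b₂
  generalize wt (Sum.inl ⟨_, u⟩) (Sum.inl ⟨_, v⟩) = p at *
  generalize wt (Sum.inl ⟨_, v⟩) (cknob C j t) = q at *
  generalize wt (cknob C j t) (ccyc C j ⟨3 * t.val, by omega⟩) = r at *
  have c₁ : q < 5 * m + 21 := by exact_mod_cast (by linarith : (q : ℝ) < 5 * m + 21)
  have c₂ : 5 * m + 19 < q := by exact_mod_cast (by linarith : (5 * m + 19 : ℝ) < q)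
  have c₃ : p + q + r < 5 * m + 26 := by
    exact_mod_cast (by linarith : (p + q + r : ℝ) < 5 * m + 26)
  have c₄ : 5 * m + 24 < p + q + r := by
    exact_mod_cast (by linarith : (5 * m + 24 : ℝ) < p + q + r)
  omega

/-- A handle edge is rounded like the first pendant edge of its variable if the literal is
positive, and opposite to it if the literal is negated. -/
lemma wt_handle {wt : GV C → GV C → ℕ}
    (hround : PathObliviousRounding (Galpha C) (ωα C) wt 1) (hdist : DistinctVars C)
    (j : Fin m) (t : Fin 3) (h : 0 < hocc C (C j t).1) :
    ((C j t).2 = true → wt (cknob C j t) (ccyc C j ⟨3 * t.val, by omega⟩) =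
      wt (vpend C (C j t).1 false) (vtri C (C j t).1 ⟨0, h⟩ 0)) ∧
    ((C j t).2 = false → wt (cknob C j t) (ccyc C j ⟨3 * t.val, by omega⟩) +
      wt (vpend C (C j t).1 false) (vtri C (C j t).1 ⟨0, h⟩ 0) = 5) := by
  obtain ⟨k, hk⟩ := exists_occs_get_eq C j t
  have h₁ := wt_pend_add_wt_tri hround (C j t).1 h k.val k.isLt (x := 2) (by decide)
  refine ⟨fun hpos => ?_, fun hneg => ?_⟩
  · have h₂ := wt_add_wt_handle hround hdist (j := j) (t := t) (u := Sum.inl (k, 0))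
      (v := Sum.inl (k, 2)) ⟨j, t, k, hk, rfl, .inr ⟨hpos, rfl⟩⟩ (by rintro ⟨⟩)
      (.inl (varRel_tri _ k (by decide)))
    change wt (vtri C _ k 0) (vtri C _ k 2) + _ = 5 at h₂
    simp only [Fin.eta] at h₁
    omega
  · have hn : (C ((occs C (C j t).1).get k).1 ((occs C (C j t).1).get k).2).2 = false := by
      rw [hk]
      exact hneg
    have h₂ := wt_add_wt_handle hround hdist (j := j) (t := t) (u := Sum.inl (k, 2))
      (v := Sum.inr (Sum.inr ⟨k, hn⟩)) ⟨j, t, k, hk, rfl, .inl ⟨hn, rfl⟩⟩ (by rintro ⟨⟩)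
      (.inr (varRel_inv _ k hn))
    change wt (vtri C _ k 2) (vinv C _ k hn) + _ = 5 at h₂
    have h₃ := wt_tri_inv hround _ k hn
    simp only [Fin.eta] at h₁
    omega

end Connection

/-! ## Clause gadgets -/

section ClauseGadget

variable {C : Fin m → Fin 3 → Fin n × Bool}

/-- The potential given on the gadget of `C_j` by `p` on the nonagon, `q` on the knobs and `r`
at the centre, and equal to `c` elsewhere. -/
noncomputable def clausePotential (C : Fin m → Fin 3 → Fin n × Bool) (j : Fin m)
    (p : Fin 9 → ℝ) (q : Fin 3 → ℝ) (r c : ℝ) : GV C → ℝ :=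
  Sum.elim (fun _ => c)
    (fun x => if x.1 = j then Sum.elim (Sum.elim p q) (fun _ => r) x.2 else c)

lemma isPotential_clausePotential (j : Fin m) {p : Fin 9 → ℝ} {q : Fin 3 → ℝ} {r c : ℝ}
    (hp : ∀ s, |p s - c| ≤ 10) (hq : ∀ t, |q t - c| ≤ 10) (hr : |r - c| ≤ 10)
    (hhandle : ∀ t : Fin 3, |q t - p ⟨3 * t.val, by omega⟩| ≤ 2.5)
    (hcycle : ∀ s : Fin 9, |p s - p (s + 1)| ≤ 3.6)
    (hcentre : ∀ s : Fin 9, |r - p s| ≤ 6) :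
    IsPotential C (clausePotential C j p q r c) := by
  have hm : (0 : ℝ) ≤ m := m.cast_nonneg
  have hnear (a : GV C) : |clausePotential C j p q r c a - c| ≤ 10 := by
    rcases a with x | ⟨j', (s | t) | _⟩ <;>
      simp only [clausePotential, Sum.elim_inl, Sum.elim_inr]
    · simp
    · split_ifs
      · exact hp s
      · simp
    · split_ifs
      · exact hq t
      · simp
    · split_ifs
      · exact hr
      · simp
  have hany (a b : GV C) : |clausePotential C j p q r c a - clausePotential C j p q r c b| ≤ 20 := by
    have ha := abs_le.1 (hnear a)
    have hb := abs_le.1 (hnear b)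
    rw [abs_le]
    constructor <;> linarith
  refine isPotential_of_rel ?_ ?_ ?_ ?_ (fun a b _ => (hany a b).trans (by linarith))
    (fun a b _ => (hany a b).trans (by linarith))
  · rintro _ _ (⟨i₁, k₁, x₁, y₁, hne, rfl, rfl⟩ | ⟨i₁, k₁, k₂, hk, rfl, rfl⟩ |
      ⟨i₁, k₁, hk, rfl, rfl⟩ | ⟨i₁, k₁, hk, rfl, rfl⟩ | ⟨i₁, k₁, hk, rfl, rfl⟩) <;>
    simp [clausePotential, vtri, vpend, vinv] <;> norm_num
  · rintro _ _ ⟨j', t, rfl, rfl⟩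
    simp only [clausePotential, cknob, ccyc, Sum.elim_inr]
    split_ifs
    · exact hhandle t
    · norm_num
  · rintro _ _ ⟨j', s, rfl, rfl⟩
    simp only [clausePotential, ccyc, Sum.elim_inr]
    split_ifs
    · exact hcycle s
    · norm_num
  · rintro _ _ ⟨j', s, rfl, rfl⟩
    simp only [clausePotential, cctr, ccyc, Sum.elim_inr]
    split_ifs
    · exact hcentre s
    · norm_num

lemma clausePotential_ccyc (j : Fin m) (p : Fin 9 → ℝ) (q : Fin 3 → ℝ) (r c : ℝ) (s : Fin 9) :
    clausePotential C j p q r c (ccyc C j s) = p s := by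
  simp [clausePotential, ccyc]

lemma clausePotential_cknob (j : Fin m) (p : Fin 9 → ℝ) (q : Fin 3 → ℝ) (r c : ℝ)
    (t : Fin 3) : clausePotential C j p q r c (cknob C j t) = q t := by
  simp [clausePotential, cknob]

/-- Distances along the nonagon from the cycle vertex `o`, truncated at `7.2`. -/
noncomputable def cycleProfile (o s : Fin 9) : ℝ :=
  ![7.2, 7.2, 7.2, 3.6, 0, 3.6, 7.2, 7.2, 7.2] (s - o + 4)

lemma cycleProfile_eq (o s : Fin 9) :
    cycleProfile o s = 0 ∨ cycleProfile o s = 3.6 ∨ cycleProfile o s = 7.2 := by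
  unfold cycleProfile
  generalize s - o + 4 = r
  fin_cases r <;> simp

/-- The potential that is `0` at cycle vertex `o` of the gadget of `C_j` and grows along the
nonagon up to `7.2`. -/
noncomputable def cyclePotential (C : Fin m → Fin 3 → Fin n × Bool) (j : Fin m) (o : Fin 9) :
    GV C → ℝ :=
  clausePotential C j (cycleProfile o) (fun t => cycleProfile o ⟨3 * t.val, by omega⟩) 3.6 3.6

lemma isPotential_cyclePotential (j : Fin m) (o : Fin 9) :
    IsPotential C (cyclePotential C j o) := by
  have h36 (s : Fin 9) : |cycleProfile o s - 3.6| ≤ 3.6 := by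
    rcases cycleProfile_eq o s with h | h | h <;> rw [h] <;> norm_num [abs_le]
  refine isPotential_clausePotential j (fun s => (h36 s).trans (by norm_num))
    (fun t => (h36 _).trans (by norm_num)) (by norm_num) (fun t => ?_) (fun s => ?_)
    (fun s => ?_)
  · norm_num
  · have e : s + 1 - o + 4 = s - o + 4 + 1 := by rw [add_sub_right_comm, add_right_comm]
    simp only [cycleProfile, e]
    generalize s - o + 4 = r
    fin_cases r <;> norm_num [abs_le, Fin.add_def]
  · rw [abs_sub_comm]
    exact (h36 s).trans (by norm_num)

/-- Two consecutive nonagon edges have rounded weight at least `7`. -/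
lemma seven_le_wt_cycle {wt : GV C → GV C → ℕ}
    (hround : PathObliviousRounding (Galpha C) (ωα C) wt 1) (j : Fin m) (o : Fin 9) :
    7 ≤ wt (ccyc C j o) (ccyc C j (o + 1)) + wt (ccyc C j (o + 1)) (ccyc C j (o + 2)) := by
  have e₀ : cyclePotential C j o (ccyc C j o) = 0 := by
    simp [cyclePotential, clausePotential_ccyc, cycleProfile]
  have e₁ : cyclePotential C j o (ccyc C j (o + 1)) = 3.6 := by
    simp [cyclePotential, clausePotential_ccyc, cycleProfile]
  have e₂ : cyclePotential C j o (ccyc C j (o + 2)) = 7.2 := by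
    simp [cyclePotential, clausePotential_ccyc, cycleProfile]
  have h₁ : IsTight C (cyclePotential C j o) (ccyc C j o) (ccyc C j (o + 1)) :=
    .of_cycle (.inl ⟨j, o, rfl, rfl⟩) (by rw [e₀, e₁]; norm_num)
  have h₂ : IsTight C (cyclePotential C j o) (ccyc C j (o + 1)) (ccyc C j (o + 2)) :=
    .of_cycle (.inl ⟨j, o + 1, rfl, by rw [add_assoc]; rfl⟩) (by rw [e₁, e₂]; norm_num)
  have h := (abs_lt.1 (h₁.abs_wt_sub_lt₂ hround (isPotential_cyclePotential j o) h₂)).1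
  rw [e₀, e₂] at h
  have : (6 : ℝ) < (wt (ccyc C j o) (ccyc C j (o + 1)) +
      wt (ccyc C j (o + 1)) (ccyc C j (o + 2)) : ℕ) := by
    push_cast
    linarith
  exact_mod_cast this

/-- Distances from the knob `c_{j,1}` inside the clause gadget, truncated on the nonagon. -/
noncomputable def knobPotential (C : Fin m → Fin 3 → Fin n × Bool) (j : Fin m) : GV C → ℝ :=
  clausePotential C j ![13.3, 9.7, 6.1, 2.5, 6.1, 9.7, 13.3, 13.3, 13.3] ![15.8, 0, 15.8] 8.5 8

lemma isPotential_knobPotential (j : Fin m) : IsPotential C (knobPotential C j) := by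
  refine isPotential_clausePotential j ?_ ?_ ?_ ?_ ?_ ?_
  · intro s
    fin_cases s <;> norm_num [abs_le]
  · intro t
    fin_cases t <;> norm_num [abs_le]
  · norm_num [abs_le]
  · intro t
    fin_cases t <;> norm_num [abs_le]
  · intro s
    fin_cases s <;> norm_num [abs_le, Fin.add_def]
  · intro s
    fin_cases s <;> norm_num [abs_le]

/-- At least one handle edge of each clause gadget is rounded down. -/
lemma exists_wt_handle_le_two {wt : GV C → GV C → ℕ}
    (hround : PathObliviousRounding (Galpha C) (ωα C) wt 1) (hwts : ∀ a b, wt a b = wt b a)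
    (j : Fin m) : ∃ t : Fin 3, wt (cknob C j t) (ccyc C j ⟨3 * t.val, by omega⟩) ≤ 2 := by
  by_contra! hup
  have hf := isPotential_knobPotential (C := C) j
  have handle (t : Fin 3) : handleRel C (cknob C j t) (ccyc C j ⟨3 * t.val, by omega⟩) :=
    ⟨j, t, rfl, rfl⟩
  have cyc (s : Fin 9) : cycleRel C (ccyc C j s) (ccyc C j (s + 1)) := ⟨j, s, rfl, rfl⟩
  have p₀ : knobPotential C j (ccyc C j 0) = 13.3 := clausePotential_ccyc ..
  have p₁ : knobPotential C j (ccyc C j 1) = 9.7 := clausePotential_ccyc ..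
  have p₂ : knobPotential C j (ccyc C j 2) = 6.1 := clausePotential_ccyc ..
  have p₃ : knobPotential C j (ccyc C j 3) = 2.5 := clausePotential_ccyc ..
  have p₄ : knobPotential C j (ccyc C j 4) = 6.1 := clausePotential_ccyc ..
  have p₅ : knobPotential C j (ccyc C j 5) = 9.7 := clausePotential_ccyc ..
  have p₆ : knobPotential C j (ccyc C j 6) = 13.3 := clausePotential_ccyc ..
  have q₀ : knobPotential C j (cknob C j 0) = 15.8 := clausePotential_cknob ..
  have q₁ : knobPotential C j (cknob C j 1) = 0 := clausePotential_cknob ..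
  have q₂ : knobPotential C j (cknob C j 2) = 15.8 := clausePotential_cknob ..
  have t₁ : IsTight C (knobPotential C j) (cknob C j 1) (ccyc C j 3) :=
    .of_light (.inr (.inr (.inl (handle 1))))
      (by rw [q₁, p₃]; norm_num)
  have t₂ : IsTight C (knobPotential C j) (ccyc C j 3) (ccyc C j 4) :=
    .of_cycle (.inl (cyc 3)) (by rw [p₃, p₄]; norm_num)
  have t₃ : IsTight C (knobPotential C j) (ccyc C j 4) (ccyc C j 5) :=
    .of_cycle (.inl (cyc 4)) (by rw [p₄, p₅]; norm_num)
  have t₄ : IsTight C (knobPotential C j) (ccyc C j 5) (ccyc C j 6) :=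
    .of_cycle (.inl (cyc 5)) (by rw [p₅, p₆]; norm_num)
  have t₅ : IsTight C (knobPotential C j) (ccyc C j 6) (cknob C j 2) :=
    .of_light (.inr (.inr (.inr (handle 2))))
      (by rw [p₆, q₂]; norm_num)
  have l₂ : IsTight C (knobPotential C j) (ccyc C j 3) (ccyc C j 2) :=
    .of_cycle (.inr (cyc 2)) (by rw [p₃, p₂]; norm_num)
  have l₃ : IsTight C (knobPotential C j) (ccyc C j 2) (ccyc C j 1) :=
    .of_cycle (.inr (cyc 1)) (by rw [p₂, p₁]; norm_num)
  have l₄ : IsTight C (knobPotential C j) (ccyc C j 1) (ccyc C j 0) :=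
    .of_cycle (.inr (cyc 0)) (by rw [p₁, p₀]; norm_num)
  have l₅ : IsTight C (knobPotential C j) (ccyc C j 0) (cknob C j 0) :=
    .of_light (.inr (.inr (.inr (handle 0))))
      (by rw [p₀, q₀]; norm_num)
  have b₁ := (abs_lt.1 (t₁.abs_wt_sub_lt₅ hround hf t₂ t₃ t₄ t₅)).2
  have b₂ := (abs_lt.1 (t₁.abs_wt_sub_lt₅ hround hf l₂ l₃ l₄ l₅)).2
  rw [q₁, q₂] at b₁
  rw [q₁, q₀] at b₂
  rw [hwts (ccyc C j 6)] at b₁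
  rw [hwts (ccyc C j 0), hwts (ccyc C j 1), hwts (ccyc C j 2), hwts (ccyc C j 3)] at b₂
  have c₁ : wt (cknob C j 1) (ccyc C j 3) + (wt (ccyc C j 3) (ccyc C j 4) +
      (wt (ccyc C j 4) (ccyc C j 5) + (wt (ccyc C j 5) (ccyc C j 6) +
        wt (cknob C j 2) (ccyc C j 6)))) < 17 := by
    rify
    linarith
  have c₂ : wt (cknob C j 1) (ccyc C j 3) + (wt (ccyc C j 2) (ccyc C j 3) +
      (wt (ccyc C j 1) (ccyc C j 2) + (wt (ccyc C j 0) (ccyc C j 1) +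
        wt (cknob C j 0) (ccyc C j 0)))) < 17 := by
    rify
    linarith
  have u₀ : 2 < wt (cknob C j 0) (ccyc C j 0) := hup 0
  have u₁ : 2 < wt (cknob C j 1) (ccyc C j 3) := hup 1
  have u₂ : 2 < wt (cknob C j 2) (ccyc C j 6) := hup 2
  have s₀ : 7 ≤ wt (ccyc C j 0) (ccyc C j 1) + wt (ccyc C j 1) (ccyc C j 2) :=
    seven_le_wt_cycle hround j 0
  have s₂ : 7 ≤ wt (ccyc C j 2) (ccyc C j 3) + wt (ccyc C j 3) (ccyc C j 4) :=
    seven_le_wt_cycle hround j 2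
  have s₄ : 7 ≤ wt (ccyc C j 4) (ccyc C j 5) + wt (ccyc C j 5) (ccyc C j 6) :=
    seven_le_wt_cycle hround j 4
  omega

end ClauseGadget

/-- If `G_α` admits a path-oblivious `1`-rounding, then the 3-CNF formula `α` (with exactly
three literals per clause and each variable appearing at most once per clause) is
satisfiable; a satisfying assignment is obtained by setting `x_i` to true if the edge
`e(v_{i,0})` is rounded down (to `2`) and to false if it is rounded up. -/
theorem rounding_implies_satisfiable {n m : ℕ}
    (C : Fin m → Fin 3 → Fin n × Bool) (hdist : DistinctVars C)
    (wt : GV C → GV C → ℕ) (hwts : ∀ a b, wt a b = wt b a)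
    (hround : PathObliviousRounding (Galpha C) (ωα C) wt 1) :
    ∃ ψ : Fin n → Bool, Satisfies C ψ ∧
      ∀ (i : Fin n) (hpos : 0 < hocc C i),
        (ψ i = true ↔ wt (vpend C i false) (vtri C i ⟨0, hpos⟩ 0) = 2) := by
  refine ⟨fun i => if h : 0 < hocc C i then
      decide (wt (vpend C i false) (vtri C i ⟨0, h⟩ 0) = 2) else false, fun j => ?_,
    fun i hpos => by simp [hpos]⟩
  obtain ⟨t, ht⟩ := exists_wt_handle_le_two hround hwts j
  obtain ⟨k, -⟩ := exists_occs_get_eq C j t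
  have h : 0 < hocc C (C j t).1 := k.pos
  have h₁ := wt_handle hround hdist j t h
  have h₂ := (wt_pend_eq hround (C j t).1 (k := ⟨0, h⟩) rfl (x := 1) (by decide)).2
  refine ⟨t, ?_⟩
  rcases hb : (C j t).2 with _ | _
  · have := h₁.2 hb
    simp only [h, dif_pos]
    simp
    omega
  · have := h₁.1 hb
    simp only [h, dif_pos]
    simp
    omega
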